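/- arXiv:2411.11557 — 3 statements merged into one kernel-verified Lean document; each statement's English description precedes it below -/
import Mathlib

section
/- Let G be a 2 leaves-free graph with m edges. Then the maximum degree of G satisfies Δ(G) ≤ ⌊(2m+1)/3⌋. -/
namespace QPaper

open SimpleGraph

/-- The signless Laplacian matrix `Q(G) = D(G) + A(G)` of a graph, over `ℝ`. -/
noncomputable def signlessLap {V : Type*} [Fintype V] [DecidableEq V] (G : SimpleGraph V) :
    Matrix V V ℝ :=
  letI := Classical.decRel G.Adj
  G.degMatrix ℝ + G.adjMatrix ℝ

/-- The `Q`-index of a graph: the largest eigenvalue of its signless Laplacian matrix. -/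
noncomputable def qIndex {V : Type*} [Fintype V] [DecidableEq V] (G : SimpleGraph V) : ℝ :=
  sSup (spectrum ℝ (signlessLap G))

/-- The number of edges (size) of a graph. -/
noncomputable def numEdges {V : Type*} (G : SimpleGraph V) : ℕ :=
  Nat.card G.edgeSet

/-- The degree of a vertex. -/
noncomputable def deg {V : Type*} (G : SimpleGraph V) (v : V) : ℕ :=
  Nat.card (G.neighborSet v)

/-- A graph is `2` leaves-free if it has at most one vertex of degree one. -/
def TwoLeavesFree {V : Type*} (G : SimpleGraph V) : Prop :=
  ∀ u v : V, deg G u = 1 → deg G v = 1 → u = v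

/-- The maximum degree `Δ(G)`. -/
noncomputable def maxDeg {V : Type*} [Fintype V] (G : SimpleGraph V) : ℕ :=
  letI := Classical.decEq V
  letI := Classical.decRel G.Adj
  G.maxDegree

/-- `k` disjoint copies of `P₂`, i.e. a perfect matching on `2k` vertices. -/
def matching (k : ℕ) : SimpleGraph (Fin k × Fin 2) :=
  SimpleGraph.fromRel (fun a b => a.1 = b.1)

/-- The star graph `Sₙ` on `n` vertices (`K_{1,n-1}` with center `0`). -/
def starGraph (n : ℕ) : SimpleGraph (Fin n) :=
  SimpleGraph.fromRel (fun a _ => (a : ℕ) = 0)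

/-- Disjoint union of two graphs. -/
def dUnion {α β : Type*} (G : SimpleGraph α) (H : SimpleGraph β) : SimpleGraph (α ⊕ β) :=
  SimpleGraph.fromRel (fun a b =>
    (∃ x y, a = Sum.inl x ∧ b = Sum.inl y ∧ G.Adj x y) ∨
    (∃ x y, a = Sum.inr x ∧ b = Sum.inr y ∧ H.Adj x y))

/-- The join `K₁ ∨ H` : a new vertex (`none`) adjacent to every vertex of `H`. -/
def cone {α : Type*} (H : SimpleGraph α) : SimpleGraph (Option α) :=
  SimpleGraph.fromRel (fun a b =>
    a = none ∨ ∃ x y, a = some x ∧ b = some y ∧ H.Adj x y)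

theorem stmt3 {V : Type*} [Fintype V] [DecidableEq V] (G : SimpleGraph V)
    (h2lf : TwoLeavesFree G) :
    maxDeg G ≤ (2 * numEdges G + 1) / 3 := by
  classical
  have hdeg (u : V) : deg G u = G.degree u := by
    rw [deg, Nat.card_eq_fintype_card, G.card_neighborSet_eq_degree]
  have hedges : numEdges G = G.edgeFinset.card := by
    rw [numEdges, Nat.card_eq_fintype_card, G.edgeFinset_card]
  have hmax : maxDeg G = G.maxDegree := by
    unfold maxDeg
    congr!
  rw [hmax, hedges, Nat.le_div_iff_mul_le (by norm_num)]
  suffices h : ∀ v, G.degree v ≤ (2 * G.edgeFinset.card + 1) / 3 by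
    have := G.maxDegree_le_of_forall_degree_le _ h
    omega
  intro v
  have hleaves : ((G.neighborFinset v).filter fun w => G.degree w = 1).card ≤ 1 := by
    refine Finset.card_le_one.2 fun a ha b hb => h2lf a b ?_ ?_
    · rw [hdeg, (Finset.mem_filter.1 ha).2]
    · rw [hdeg, (Finset.mem_filter.1 hb).2]
  have hneighbors : 2 * G.degree v ≤ ∑ w ∈ G.neighborFinset v, G.degree w + 1 := by
    calc 2 * G.degree v = ∑ w ∈ G.neighborFinset v, 2 := by
          rw [Finset.sum_const, G.card_neighborFinset_eq_degree, smul_eq_mul, mul_comm]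
      _ ≤ ∑ w ∈ G.neighborFinset v, (G.degree w + if G.degree w = 1 then 1 else 0) := by
          refine Finset.sum_le_sum fun w hw => ?_
          have hpos : 0 < G.degree w :=
            (G.degree_pos_iff_exists_adj w).2 ⟨v, ((G.mem_neighborFinset v w).1 hw).symm⟩
          split_ifs <;> omega
      _ ≤ ∑ w ∈ G.neighborFinset v, G.degree w + 1 := by
          rw [Finset.sum_add_distrib, ← Finset.card_filter]
          omega
  have htotal : G.degree v + ∑ w ∈ G.neighborFinset v, G.degree w ≤ 2 * G.edgeFinset.card := by
    rw [← G.sum_degrees_eq_twice_card_edges,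
      ← Finset.sum_insert (f := fun w => G.degree w) (G.notMem_neighborFinset_self v)]
    exact Finset.sum_le_sum_of_subset (Finset.subset_univ _)
  omega

end QPaper
end

section
/- Let F be a forest with r components, minimum degree δ(F) = 1, and s edges. Then q(K_1 ∨ (F ∪ P_1)) ≤ q(K_1 ∨ (S_{s−r+2} ∪ (r−1)P_2 ∪ P_1)), with equality if and only if F is isomorphic to S_{s−r+2} ∪ (r−1)P_2. -/
namespace QPaper

open SimpleGraph

open Classical in
theorem deg_eq_degree {V : Type*} [Fintype V] (G : SimpleGraph V) (v : V) :
    deg G v = G.degree v := by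
  rw [deg, Nat.card_eq_fintype_card, card_neighborSet_eq_degree]

open Classical in
theorem cast_deg {V : Type*} [Fintype V] (G : SimpleGraph V) (v : V) :
    (deg G v : ℝ) = ∑ w, if G.Adj v w then 1 else 0 := by
  rw [deg_eq_degree, G.degree_eq_sum_if_adj]

section Spectral

variable {V : Type*} [Fintype V] [DecidableEq V] (G : SimpleGraph V)

open Classical in
theorem signlessLap_mulVec (x : V → ℝ) (v : V) :
    (signlessLap G).mulVec x v = ∑ w, if G.Adj v w then x v + x w else 0 := by
  simp only [signlessLap, Matrix.add_mulVec, Pi.add_apply]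
  rw [degMatrix_mulVec_apply, adjMatrix_mulVec_apply, degree_eq_sum_if_adj (R := ℝ), Finset.sum_mul,
    neighborFinset_eq_filter, Finset.sum_filter, ← Finset.sum_add_distrib]
  refine Finset.sum_congr rfl fun w _ => ?_
  split_ifs <;> simp

theorem signlessLap_isSymm : (signlessLap G).IsSymm := by
  let := Classical.decRel G.Adj
  exact (G.isSymm_degMatrix (R := ℝ)).add (G.isSymm_adjMatrix (α := ℝ))

theorem signlessLap_isHermitian : (signlessLap G).IsHermitian := by
  rw [Matrix.IsHermitian, Matrix.conjTranspose_eq_transpose_of_trivial, signlessLap_isSymm]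

theorem mem_spectrum_signlessLap {μ : ℝ} :
    μ ∈ spectrum ℝ (signlessLap G) ↔ ∃ z, z ≠ 0 ∧ (signlessLap G).mulVec z = μ • z := by
  rw [← Matrix.spectrum_toLin', ← Module.End.hasEigenvalue_iff_mem_spectrum]
  constructor
  · intro h
    obtain ⟨z, hz⟩ := h.exists_hasEigenvector
    exact ⟨z, hz.2, by simpa using hz.apply_eq_smul⟩
  · rintro ⟨z, hz0, hz⟩
    exact Module.End.hasEigenvalue_of_hasEigenvector
      ⟨Module.End.mem_eigenspace_iff.2 (by simpa using hz), hz0⟩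

theorem qIndex_mem_spectrum [Nonempty V] : qIndex G ∈ spectrum ℝ (signlessLap G) := by
  refine Set.Nonempty.csSup_mem ?_ (Matrix.finite_real_spectrum)
  rw [(signlessLap_isHermitian G).spectrum_real_eq_range_eigenvalues]
  exact Set.range_nonempty _

theorem le_qIndex {μ : ℝ} (h : μ ∈ spectrum ℝ (signlessLap G)) : μ ≤ qIndex G :=
  le_csSup Matrix.finite_real_spectrum.bddAbove h

theorem abs_mul_le_signlessLap_abs {z : V → ℝ} {μ : ℝ} (h : (signlessLap G).mulVec z = μ • z)
    (v : V) : μ * |z v| ≤ (signlessLap G).mulVec (fun w => |z w|) v := by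
  calc μ * |z v| ≤ |μ * z v| := by rw [abs_mul]; gcongr; exact le_abs_self μ
    _ = |(signlessLap G).mulVec z v| := by rw [h]; rfl
    _ ≤ _ := by
      rw [signlessLap_mulVec, signlessLap_mulVec]
      refine (Finset.abs_sum_le_sum_abs _ _).trans (Finset.sum_le_sum fun w _ => ?_)
      split_ifs
      · exact abs_add_le _ _
      · simp

theorem signlessLap_dotProduct_comm (x y : V → ℝ) :
    ∑ v, x v * (signlessLap G).mulVec y v = ∑ v, (signlessLap G).mulVec x v * y v := by
  have := Matrix.dotProduct_mulVec x (signlessLap G) y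
  rw [← Matrix.mulVec_transpose, signlessLap_isSymm] at this
  exact this

/-- A positive vector `x` with `Q x ≤ q x` bounds the spectrum of `Q` from above. -/
theorem le_of_supersolution {x : V → ℝ} {q μ : ℝ} (hx : ∀ v, 0 < x v)
    (hq : ∀ v, (signlessLap G).mulVec x v ≤ q * x v) (hμ : μ ∈ spectrum ℝ (signlessLap G)) :
    μ ≤ q := by
  obtain ⟨z, hz0, hz⟩ := (mem_spectrum_signlessLap G).1 hμ
  have hpos : 0 < ∑ v, |z v| * x v := by
    obtain ⟨v, hv⟩ := Function.ne_iff.1 hz0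
    exact Finset.sum_pos' (fun w _ => mul_nonneg (abs_nonneg _) (hx w).le)
      ⟨v, Finset.mem_univ v, mul_pos (abs_pos.2 hv) (hx v)⟩
  refine le_of_mul_le_mul_right ?_ hpos
  calc μ * ∑ v, |z v| * x v = ∑ v, μ * |z v| * x v := by simp only [Finset.mul_sum, mul_assoc]
    _ ≤ ∑ v, (signlessLap G).mulVec (fun w => |z w|) v * x v := Finset.sum_le_sum fun v _ =>
        mul_le_mul_of_nonneg_right (abs_mul_le_signlessLap_abs G hz v) (hx v).le
    _ = ∑ v, |z v| * (signlessLap G).mulVec x v := (signlessLap_dotProduct_comm G _ _).symm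
    _ ≤ ∑ v, |z v| * (q * x v) := Finset.sum_le_sum fun v _ =>
        mul_le_mul_of_nonneg_left (hq v) (abs_nonneg _)
    _ = q * ∑ v, |z v| * x v := by
        rw [Finset.mul_sum]; exact Finset.sum_congr rfl fun v _ => by ring

theorem qIndex_le_of_supersolution [Nonempty V] {x : V → ℝ} {q : ℝ} (hx : ∀ v, 0 < x v)
    (hq : ∀ v, (signlessLap G).mulVec x v ≤ q * x v) : qIndex G ≤ q :=
  le_of_supersolution G hx hq (qIndex_mem_spectrum G)

theorem qIndex_eq_of_pos_eigenvector [Nonempty V] {x : V → ℝ} {q : ℝ} (hx : ∀ v, 0 < x v)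
    (hq : ∀ v, (signlessLap G).mulVec x v = q * x v) : qIndex G = q := by
  refine (qIndex_le_of_supersolution G hx fun v => (hq v).le).antisymm (le_qIndex G ?_)
  refine (mem_spectrum_signlessLap G).2 ⟨x, fun h => ?_, funext hq⟩
  obtain ⟨v⟩ := ‹Nonempty V›
  exact (hx v).ne' (congrFun h v)

/-- If a graph has a dominating vertex, a positive supersolution for its own `Q`-index is an
eigenvector. -/
theorem eq_of_supersolution_qIndex {x : V → ℝ} (hx : ∀ v, 0 < x v)
    (hq : ∀ v, (signlessLap G).mulVec x v ≤ qIndex G * x v) (c : V)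
    (hc : ∀ v, v ≠ c → G.Adj c v) (v : V) :
    (signlessLap G).mulVec x v = qIndex G * x v := by
  have : Nonempty V := ⟨c⟩
  obtain ⟨z, hz0, hz⟩ := (mem_spectrum_signlessLap G).1 (qIndex_mem_spectrum G)
  set q := qIndex G
  have h1 : ∀ v ∈ Finset.univ, q * |z v| * x v ≤
      (signlessLap G).mulVec (fun w => |z w|) v * x v := fun v _ =>
    mul_le_mul_of_nonneg_right (abs_mul_le_signlessLap_abs G hz v) (hx v).le
  have h2 : ∀ v ∈ Finset.univ, |z v| * (signlessLap G).mulVec x v ≤ |z v| * (q * x v) :=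
    fun v _ => mul_le_mul_of_nonneg_left (hq v) (abs_nonneg _)
  have h3 := signlessLap_dotProduct_comm G (fun w => |z w|) x
  have h4 : ∑ v, q * |z v| * x v = ∑ v, |z v| * (q * x v) :=
    Finset.sum_congr rfl fun v _ => by ring
  have e1 := (Finset.sum_eq_sum_iff_of_le h1).1
    ((Finset.sum_le_sum h1).antisymm (by rw [h4, ← h3]; exact Finset.sum_le_sum h2))
  have e2 := (Finset.sum_eq_sum_iff_of_le h2).1
    ((Finset.sum_le_sum h2).antisymm (by rw [h3, ← h4]; exact Finset.sum_le_sum h1))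
  have e3 : ∀ v, q * |z v| = (signlessLap G).mulVec (fun w => |z w|) v := fun v =>
    mul_right_cancel₀ (hx v).ne' (e1 v (Finset.mem_univ v))
  have hterm : ∀ u w, G.Adj u w → |z w| ≤ q * |z u| := by
    classical
    intro u w huw
    rw [e3, signlessLap_mulVec]
    refine le_trans ?_ (Finset.single_le_sum (f := fun w => if G.Adj u w then |z u| + |z w| else 0)
      (fun w _ => ?_) (Finset.mem_univ w))
    · simp [huw]
    · split_ifs <;> positivity
  have hcz : z c ≠ 0 := by
    intro h0
    refine hz0 (funext fun w => ?_)
    by_cases hw : w = c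
    · rw [hw, h0]; rfl
    · have := hterm c w (hc w hw)
      rw [h0, abs_zero, mul_zero] at this
      exact abs_nonpos_iff.1 this
  have hvz : z v ≠ 0 := by
    intro h0
    by_cases hv : v = c
    · exact hcz (hv ▸ h0)
    · have := hterm v c (hc v hv).symm
      rw [h0, abs_zero, mul_zero] at this
      exact hcz (abs_nonpos_iff.1 this)
  exact mul_left_cancel₀ (abs_ne_zero.2 hvz) (e2 v (Finset.mem_univ v))

theorem spectrum_subset_of_iso {W : Type*} [Fintype W] [DecidableEq W] {H : SimpleGraph W}
    (e : G ≃g H) : spectrum ℝ (signlessLap H) ⊆ spectrum ℝ (signlessLap G) := by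
  classical
  intro μ hμ
  obtain ⟨z, hz0, hz⟩ := (mem_spectrum_signlessLap H).1 hμ
  refine (mem_spectrum_signlessLap G).2 ⟨z ∘ e, fun h => hz0 (funext fun w => ?_),
    funext fun v => ?_⟩
  · simpa using congrFun h (e.symm w)
  · have := congrFun hz (e v)
    rw [signlessLap_mulVec] at this
    rw [signlessLap_mulVec]
    refine Eq.trans (Fintype.sum_equiv e.toEquiv _ _ fun w => ?_) this
    simp [e.map_adj_iff]

theorem qIndex_congr {W : Type*} [Fintype W] [DecidableEq W] {H : SimpleGraph W} (e : G ≃g H) :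
    qIndex G = qIndex H := by
  rw [qIndex, qIndex, (spectrum_subset_of_iso G e).antisymm (spectrum_subset_of_iso H e.symm)]

end Spectral

section Cone

variable {W U : Type*}

@[simp] theorem cone_adj_none_some (H : SimpleGraph W) (v : W) : (cone H).Adj none (some v) := by
  simp [cone]

@[simp] theorem cone_adj_some_none (H : SimpleGraph W) (v : W) : (cone H).Adj (some v) none := by
  simp [cone]

@[simp] theorem cone_adj_some_some (H : SimpleGraph W) (v w : W) :
    (cone H).Adj (some v) (some w) ↔ H.Adj v w := by
  simp only [cone, fromRel_adj]
  constructor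
  · rintro ⟨-, (h | ⟨x, y, h1, h2, h⟩) | (h | ⟨x, y, h1, h2, h⟩)⟩ <;> simp_all [H.adj_comm]
  · intro h
    exact ⟨by simpa using h.ne, Or.inl (Or.inr ⟨v, w, rfl, rfl, h⟩)⟩

@[simp] theorem dUnion_adj_inl (G : SimpleGraph W) (H : SimpleGraph U) (v w : W) :
    (dUnion G H).Adj (Sum.inl v) (Sum.inl w) ↔ G.Adj v w := by
  simp only [dUnion, fromRel_adj]
  constructor
  · rintro ⟨-, (⟨x, y, h1, h2, h⟩ | ⟨x, y, h1, h2, h⟩) | (⟨x, y, h1, h2, h⟩ | ⟨x, y, h1, h2, h⟩)⟩ <;>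
      simp_all [G.adj_comm]
  · intro h
    exact ⟨by simpa using h.ne, Or.inl (Or.inl ⟨v, w, rfl, rfl, h⟩)⟩

@[simp] theorem dUnion_adj_inr (G : SimpleGraph W) (H : SimpleGraph U) (v w : U) :
    (dUnion G H).Adj (Sum.inr v) (Sum.inr w) ↔ H.Adj v w := by
  simp only [dUnion, fromRel_adj]
  constructor
  · rintro ⟨-, (⟨x, y, h1, h2, h⟩ | ⟨x, y, h1, h2, h⟩) | (⟨x, y, h1, h2, h⟩ | ⟨x, y, h1, h2, h⟩)⟩ <;>
      simp_all [H.adj_comm]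
  · intro h
    exact ⟨by simpa using h.ne, Or.inl (Or.inr ⟨v, w, rfl, rfl, h⟩)⟩

@[simp] theorem not_dUnion_adj_inl_inr (G : SimpleGraph W) (H : SimpleGraph U) (v : W) (w : U) :
    ¬ (dUnion G H).Adj (Sum.inl v) (Sum.inr w) := by
  simp [dUnion]

@[simp] theorem not_dUnion_adj_inr_inl (G : SimpleGraph W) (H : SimpleGraph U) (v : W) (w : U) :
    ¬ (dUnion G H).Adj (Sum.inr w) (Sum.inl v) := by
  simp [dUnion]

/-- Isomorphic graphs have isomorphic cones. -/
def coneIso {G : SimpleGraph W} {H : SimpleGraph U} (e : G ≃g H) : cone G ≃g cone H where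
  toEquiv := e.toEquiv.optionCongr
  map_rel_iff' := by
    rintro (_ | a) (_ | b) <;> simp [e.map_adj_iff]

/-- Disjoint union respects isomorphism in its first argument. -/
def dUnionIsoLeft {X : Type*} {G : SimpleGraph W} {H : SimpleGraph U} (e : G ≃g H)
    (K : SimpleGraph X) : dUnion G K ≃g dUnion H K where
  toEquiv := e.toEquiv.sumCongr (Equiv.refl X)
  map_rel_iff' := by
    rintro (a | a) (b | b) <;> simp [e.map_adj_iff]

/-- Disjoint union is associative up to isomorphism. -/
def dUnionAssoc {X : Type*} (G : SimpleGraph W) (H : SimpleGraph U) (K : SimpleGraph X) :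
    dUnion (dUnion G H) K ≃g dUnion G (dUnion H K) where
  toEquiv := Equiv.sumAssoc W U X
  map_rel_iff' := by
    rintro ((a | a) | a) ((b | b) | b) <;> simp

/-- The test vector on a cone over `H`: value `1` at the apex and `(1 + 2 d(v) a(v)) / t`
at a vertex `v` of `H`. -/
noncomputable def coneVec (H : SimpleGraph W) (a : W → ℝ) (t : ℝ) : Option W → ℝ
  | none => 1
  | some v => (1 + 2 * deg H v * a v) / t

theorem coneVec_pos (H : SimpleGraph W) {a : W → ℝ} {t : ℝ} (ha : ∀ v, 0 ≤ a v) (ht : 0 < t)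
    (o : Option W) : 0 < coneVec H a t o := by
  cases o with
  | none => exact one_pos
  | some v =>
    have := ha v
    simp only [coneVec]
    positivity

variable [Fintype W] [Fintype U]

open Classical in
@[simp] theorem deg_dUnion_inl (G : SimpleGraph W) (H : SimpleGraph U) (v : W) :
    deg (dUnion G H) (Sum.inl v) = deg G v := by
  apply Nat.cast_injective (R := ℝ)
  rw [cast_deg, cast_deg, Fintype.sum_sum_type]
  simp only [not_dUnion_adj_inl_inr, if_false, Finset.sum_const_zero, add_zero]
  exact Finset.sum_congr rfl fun w _ => if_congr (dUnion_adj_inl G H v w) rfl rfl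

open Classical in
@[simp] theorem deg_dUnion_inr (G : SimpleGraph W) (H : SimpleGraph U) (v : U) :
    deg (dUnion G H) (Sum.inr v) = deg H v := by
  apply Nat.cast_injective (R := ℝ)
  rw [cast_deg, cast_deg, Fintype.sum_sum_type]
  simp only [not_dUnion_adj_inr_inl, if_false, Finset.sum_const_zero, zero_add]
  exact Finset.sum_congr rfl fun w _ => if_congr (dUnion_adj_inr G H v w) rfl rfl

@[simp] theorem deg_pathGraph_one (v : Fin 1) : deg (pathGraph 1) v = 0 := by
  simp [deg, neighborSet, Subsingleton.elim _ v]

theorem starGraph_adj {n : ℕ} (a b : Fin n) :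
    (starGraph n).Adj a b ↔ a ≠ b ∧ ((a : ℕ) = 0 ∨ (b : ℕ) = 0) := by
  simp [starGraph]

theorem matching_adj {k : ℕ} (a b : Fin k × Fin 2) :
    (matching k).Adj a b ↔ a ≠ b ∧ a.1 = b.1 := by
  simp only [matching, fromRel_adj, and_congr_right_iff]
  exact fun _ => ⟨fun h => h.elim id Eq.symm, Or.inl⟩

@[simp] theorem deg_starGraph_zero (m : ℕ) : deg (starGraph (m + 1)) 0 = m := by
  have : (starGraph (m + 1)).neighborSet 0 = {0}ᶜ := by
    ext b; simp [starGraph_adj, eq_comm]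
  rw [deg, this, Nat.card_coe_set_eq, Set.ncard_compl]
  simp

@[simp] theorem deg_starGraph_succ (m : ℕ) (i : Fin m) :
    deg (starGraph (m + 1)) i.succ = 1 := by
  have : (starGraph (m + 1)).neighborSet i.succ = {0} := by
    ext b
    refine b.cases ?_ (fun j => ?_) <;> simp [starGraph_adj, Fin.succ_ne_zero]
  rw [deg, this, Nat.card_coe_set_eq, Set.ncard_singleton]

@[simp] theorem deg_matching {k : ℕ} (a : Fin k × Fin 2) : deg (matching k) a = 1 := by
  have : (matching k).neighborSet a = {(a.1, a.2 + 1)} := by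
    ext b
    obtain ⟨a1, a2⟩ := a
    obtain ⟨b1, b2⟩ := b
    simp only [mem_neighborSet, matching_adj, Set.mem_singleton_iff, Prod.mk.injEq, ne_eq]
    fin_cases a2 <;> fin_cases b2 <;> simp [eq_comm]
  rw [deg, this, Nat.card_coe_set_eq, Set.ncard_singleton]

theorem signlessLap_coneVec_none [DecidableEq W] (H : SimpleGraph W) (a : W → ℝ) {t : ℝ} :
    (signlessLap (cone H)).mulVec (coneVec H a t) none =
      Fintype.card W * (1 + 1 / t) + 2 / t * ∑ v, deg H v * a v := by
  rw [signlessLap_mulVec]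
  simp only [Fintype.sum_option, SimpleGraph.irrefl, if_false, cone_adj_none_some, if_true,
    coneVec, zero_add, add_div, Finset.sum_add_distrib, Finset.sum_const, Finset.card_univ,
    nsmul_eq_mul, Finset.mul_sum]
  rw [mul_add, mul_one, add_assoc]
  congr 2
  exact Finset.sum_congr rfl fun v _ => by ring

open Classical in
theorem signlessLap_coneVec_some [DecidableEq W] (H : SimpleGraph W) (a : W → ℝ) {t : ℝ}
    (ht : t ≠ 0) (v : W) :
    (signlessLap (cone H)).mulVec (coneVec H a t) (some v) = (t + 1) * coneVec H a t (some v) +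
      2 / t * ∑ w, if H.Adj v w then 1 + deg H v * a v + deg H w * a w - t * a v else 0 := by
  rw [signlessLap_mulVec]
  simp only [Fintype.sum_option, cone_adj_some_none, cone_adj_some_some, if_true, coneVec]
  have h : (t + 1) * ((1 + 2 * deg H v * a v) / t) =
      1 + (1 + 2 * deg H v * a v) / t + ∑ w, if H.Adj v w then 2 * a v else 0 := by
    have : (∑ w, if H.Adj v w then 2 * a v else 0) = deg H v * (2 * a v) := by
      rw [cast_deg, Finset.sum_mul]
      exact Finset.sum_congr rfl fun w _ => by split_ifs <;> simp
    rw [this]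
    field_simp
    ring
  have h' : (∑ w, if H.Adj v w then (1 + 2 * deg H v * a v) / t + (1 + 2 * deg H w * a w) / t
      else 0) = (∑ w, if H.Adj v w then 2 * a v else 0) +
      2 / t * ∑ w, if H.Adj v w then 1 + deg H v * a v + deg H w * a w - t * a v else 0 := by
    rw [Finset.mul_sum, ← Finset.sum_add_distrib]
    refine Finset.sum_congr rfl fun w _ => ?_
    split_ifs
    · field_simp
      ring
    · simp
  rw [h, h']
  ring

end Cone

section Extremal

theorem exists_balance (m k : ℕ) : ∃ t : ℝ, m + 2 < t ∧
    t + 1 = (m + 2 * k + 3) * (1 + 1 / t) +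
      2 / t * (2 * (m + 1) / (t - (m + 2)) + 2 * k / (t - 2)) := by
  have hm : (0 : ℝ) ≤ m := m.cast_nonneg
  have hk : (0 : ℝ) ≤ k := k.cast_nonneg
  set b : ℝ := m + 2 * k + 3 with hb
  let f : ℝ → ℝ := fun t =>
    (t + 1) * (t - b) - (4 * (m + 1) / (t - (m + 2)) + 4 * k / (t - 2))
  have hcont : ContinuousOn f (Set.Icc b (5 * b)) := by
    have h1 : ∀ t ∈ Set.Icc b (5 * b), t - (m + 2) ≠ 0 := fun t ht => by
      have := ht.1; apply ne_of_gt; linarith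
    have h2 : ∀ t ∈ Set.Icc b (5 * b), t - 2 ≠ 0 := fun t ht => by
      have := ht.1; apply ne_of_gt; linarith
    fun_prop (disch := assumption)
  have hlo : f b ≤ 0 := by
    have h1 : 0 ≤ 4 * (m + 1 : ℝ) / (b - (m + 2)) := div_nonneg (by linarith) (by linarith)
    have h2 : 0 ≤ 4 * (k : ℝ) / (b - 2) := div_nonneg (by linarith) (by linarith)
    simp only [f, sub_self, mul_zero]
    linarith
  have hhi : 0 ≤ f (5 * b) := by
    have h1 : 4 * (m + 1 : ℝ) / (5 * b - (m + 2)) ≤ 4 * (m + 1) :=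
      div_le_self (by linarith) (by linarith)
    have h2 : 4 * (k : ℝ) / (5 * b - 2) ≤ 4 * k := div_le_self (by linarith) (by linarith)
    have h3 : 0 ≤ b * b := mul_self_nonneg b
    have : f (5 * b) = (5 * b + 1) * (4 * b) -
      (4 * (m + 1) / (5 * b - (m + 2)) + 4 * k / (5 * b - 2)) := by simp only [f]; ring
    rw [this]
    linarith
  obtain ⟨t, ht, hft⟩ := intermediate_value_Icc (by linarith : b ≤ 5 * b) hcont ⟨hlo, hhi⟩
  refine ⟨t, by linarith [ht.1], ?_⟩
  have ht0 : t ≠ 0 := by apply ne_of_gt; linarith [ht.1]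
  simp only [f] at hft
  have h4 : 2 / t * (2 * (m + 1) / (t - (m + 2)) + 2 * k / (t - 2)) =
      (4 * (m + 1) / (t - (m + 2)) + 4 * k / (t - 2)) / t := by ring
  rw [h4, ← sub_eq_zero.1 hft]
  field_simp
  ring

theorem qIndex_cone_star_matching (m k : ℕ) {t : ℝ} (ht : m + 2 < t)
    (h : t + 1 = (m + 2 * k + 3) * (1 + 1 / t) +
      2 / t * (2 * (m + 1) / (t - (m + 2)) + 2 * k / (t - 2))) :
    qIndex (cone (dUnion (starGraph (m + 2)) (dUnion (matching k) (pathGraph 1)))) = t + 1 := by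
  have hm : (0 : ℝ) ≤ m := m.cast_nonneg
  have ht0 : 0 < t := by linarith
  have ht1 : t - (m + 2) ≠ 0 := by apply ne_of_gt; linarith
  have ht2 : t - 2 ≠ 0 := by apply ne_of_gt; linarith
  let a : Fin (m + 2) ⊕ ((Fin k × Fin 2) ⊕ Fin 1) → ℝ :=
    Sum.elim (fun _ => 1 / (t - (m + 2))) (Sum.elim (fun _ => 1 / (t - 2)) fun _ => 0)
  have ha : ∀ v, 0 ≤ a v := by
    have h1 : 0 ≤ 1 / (t - (m + 2)) := one_div_nonneg.2 (by linarith)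
    have h2 : 0 ≤ 1 / (t - 2) := one_div_nonneg.2 (by linarith)
    rintro (v | v | v)
    exacts [h1, h2, le_rfl]
  let H := dUnion (starGraph (m + 2)) (dUnion (matching k) (pathGraph 1))
  refine qIndex_eq_of_pos_eigenvector (cone H) (coneVec_pos H ha ht0) fun o => ?_
  cases o with
  | none =>
    rw [signlessLap_coneVec_none]
    simp only [H, Fintype.sum_sum_type, deg_dUnion_inl, deg_dUnion_inr, a, Sum.elim_inl,
      Sum.elim_inr, deg_pathGraph_one, deg_matching, Fin.sum_univ_succ, deg_starGraph_zero,
      deg_starGraph_succ, Finset.sum_const, Finset.card_univ, Fintype.card_sum, Fintype.card_prod, Fintype.card_fin,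
      coneVec, nsmul_eq_mul]
    rw [mul_one, h]
    push_cast
    ring
  | some v =>
    classical
    rw [signlessLap_coneVec_some _ _ ht0.ne', Finset.sum_eq_zero, mul_zero, add_zero]
    intro w _
    split_ifs with hvw
    · rcases v with (v | v | v) <;> rcases w with (w | w | w) <;>
        simp only [H, dUnion_adj_inl, dUnion_adj_inr, not_dUnion_adj_inl_inr,
          not_dUnion_adj_inr_inl] at hvw
      · have : (deg (starGraph (m + 2)) v + deg (starGraph (m + 2)) w : ℝ) = m + 2 := by
          rw [starGraph_adj] at hvw
          induction v using Fin.cases <;> induction w using Fin.cases <;> simp at hvw ⊢ <;> ring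
        simp only [H, deg_dUnion_inl, a, Sum.elim_inl]
        field_simp
        linarith
      · simp only [H, deg_dUnion_inl, deg_dUnion_inr, a, Sum.elim_inl, Sum.elim_inr, deg_matching]
        field_simp
        push_cast
        ring
      · simp [Subsingleton.elim v w] at hvw
    · rfl

end Extremal

section Forest

open Classical in
/-- The number of vertices of a connected component. -/
noncomputable def compSize {V : Type*} [Fintype V] {F : SimpleGraph V}
    (C : F.ConnectedComponent) : ℕ :=
  Finset.card {v | F.connectedComponentMk v = C}

variable {V : Type*} [Fintype V] {F : SimpleGraph V}

open Classical in
theorem sum_compSize [Fintype F.ConnectedComponent] :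
    ∑ C : F.ConnectedComponent, compSize C = Fintype.card V := by
  rw [← Finset.card_univ, Finset.card_eq_sum_card_fiberwise
    (f := F.connectedComponentMk) (t := Finset.univ)
    (fun _ _ => Finset.mem_coe.2 (Finset.mem_univ _))]
  rfl

open Classical in
theorem sum_deg_component (hF : F.IsAcyclic) (C : F.ConnectedComponent) :
    (∑ v with F.connectedComponentMk v = C, deg F v) + 2 = 2 * compSize C := by
  have htree : (F.induce C.supp).IsTree := hF.isTree_connectedComponent C
  have h1 := (F.induce C.supp).sum_degrees_eq_twice_card_edges
  have h2 := htree.card_edgeFinset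
  have h3 : ∑ v : C.supp, (F.induce C.supp).degree v =
      ∑ v with F.connectedComponentMk v = C, deg F v := by
    rw [Finset.sum_subtype (p := (· ∈ C.supp)) _ (by simp)]
    refine Finset.sum_congr rfl fun v _ => ?_
    rw [deg_eq_degree, degree_induce_of_neighborSet_subset]
    exact fun w hw => (C.mem_supp_congr_adj hw).1 v.2
  have h4 : Fintype.card C.supp = compSize C := by
    rw [compSize, Fintype.card_subtype]
    simp
  omega

theorem sum_deg_eq (F : SimpleGraph V) : ∑ v, deg F v = 2 * numEdges F := by
  classical
  simp only [deg_eq_degree, sum_degrees_eq_twice_card_edges, numEdges, Nat.card_eq_fintype_card,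
    edgeFinset_card]

open Classical in
theorem sum_deg_add_two_mul_card_component [Fintype F.ConnectedComponent] (hF : F.IsAcyclic) :
    ∑ v, deg F v + 2 * Fintype.card F.ConnectedComponent = 2 * Fintype.card V := by
  rw [← sum_compSize (F := F), ← Finset.sum_fiberwise Finset.univ F.connectedComponentMk,
    Finset.mul_sum, ← Finset.sum_congr rfl fun C _ => sum_deg_component hF C,
    Finset.sum_add_distrib]
  simp [mul_comm]

theorem card_eq_numEdges_add_card_component (hF : F.IsAcyclic) :
    Fintype.card V = numEdges F + Nat.card F.ConnectedComponent := by
  classical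
  have : Fintype F.ConnectedComponent := Fintype.ofFinite _
  have h1 := sum_deg_add_two_mul_card_component hF
  rw [sum_deg_eq] at h1
  rw [Nat.card_eq_fintype_card]
  omega

variable (hF : F.IsAcyclic) (hdeg : ∀ v, 1 ≤ deg F v)
include hF hdeg

open Classical in
theorem two_le_compSize (C : F.ConnectedComponent) : 2 ≤ compSize C := by
  have h1 := sum_deg_component hF C
  have h2 := Finset.card_nsmul_le_sum {v | F.connectedComponentMk v = C} (fun v => deg F v) 1
    fun v _ => hdeg v
  rw [smul_eq_mul, mul_one] at h2
  change compSize C ≤ _ at h2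
  omega

open Classical in
theorem deg_add_deg_le_compSize {v w : V} (hvw : v ≠ w)
    (h : F.connectedComponentMk v = F.connectedComponentMk w) :
    deg F v + deg F w ≤ compSize (F.connectedComponentMk v) := by
  have h1 := sum_deg_component hF (F.connectedComponentMk v)
  set S : Finset V := {u | F.connectedComponentMk u = F.connectedComponentMk v} with hS
  have hsub : {v, w} ⊆ S := by
    intro u hu
    rcases Finset.mem_insert.1 hu with rfl | hu
    · simp [hS]
    · rw [Finset.mem_singleton.1 hu]; simp [hS, h]
  have h2 := Finset.sum_sdiff (f := fun v => deg F v) hsub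
  have h3 := Finset.card_nsmul_le_sum (S \ {v, w}) (fun v => deg F v) 1 fun v _ => hdeg v
  rw [smul_eq_mul, mul_one, Finset.card_sdiff_of_subset hsub, Finset.card_pair hvw] at h3
  rw [Finset.sum_pair hvw] at h2
  have h4 : S.card = compSize (F.connectedComponentMk v) := rfl
  omega

open Classical in
/-- If every edge `vw` of a forest component satisfies `d(v) + d(w) = |C|`, the component is a
star. -/
theorem exists_center_of_deg_add_deg_eq (C : F.ConnectedComponent)
    (h : ∀ v w, F.Adj v w → F.connectedComponentMk v = C → deg F v + deg F w = compSize C) :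
    ∃ u, ∀ v, F.connectedComponentMk v = C → v ≠ u → deg F v = 1 := by
  have h1 := sum_deg_component hF C
  obtain ⟨l, hl, hl1⟩ : ∃ l, F.connectedComponentMk l = C ∧ deg F l = 1 := by
    by_contra! hcon
    have h2 := Finset.card_nsmul_le_sum {v | F.connectedComponentMk v = C} (fun v => deg F v) 2
      fun v hv => by
        have := hdeg v
        have := hcon v (Finset.mem_filter.1 hv).2
        omega
    change compSize C • 2 ≤ _ at h2
    rw [smul_eq_mul] at h2
    omega
  obtain ⟨u, hu⟩ : ∃ u, F.Adj l u := by
    have : 0 < F.degree l := by rw [← deg_eq_degree]; omega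
    exact (F.degree_pos_iff_exists_adj l).1 this
  have huC : F.connectedComponentMk u = C := by
    rw [← hl]; exact (ConnectedComponent.sound hu.reachable).symm
  refine ⟨u, fun v hv hvu => ?_⟩
  have h2 := deg_add_deg_le_compSize hF hdeg hvu (hv.trans huC.symm)
  have h3 := h l u hu hl
  have h4 := hdeg v
  rw [hv] at h2
  omega

theorem deg_eq_one_of_compSize_eq_two {v : V}
    (h : compSize (F.connectedComponentMk v) = 2) : deg F v = 1 := by
  classical
  obtain ⟨u, hu⟩ : ∃ u, F.Adj v u := by
    have : 0 < F.degree v := by rw [← deg_eq_degree]; exact hdeg v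
    exact (F.degree_pos_iff_exists_adj v).1 this
  have h1 := deg_add_deg_le_compSize hF hdeg hu.ne (ConnectedComponent.sound hu.reachable)
  have h2 := hdeg v
  have h3 := hdeg u
  omega

end Forest

section ComponentSizes

theorem chord_sub {t K N : ℝ} (hN : N < t) (hK : K < t) (ht : 2 < t) :
    2 / (t - 2) + 2 * (t - 1) * (N - 2) / ((t - K) * (t - 2)) - (2 * N - 2) / (t - N) =
      2 * (t - 1) * (N - 2) * (K - N) / ((t - K) * (t - N) * (t - 2)) := by
  have h1 : t - N ≠ 0 := (sub_pos.2 hN).ne'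
  have h2 : t - K ≠ 0 := (sub_pos.2 hK).ne'
  have h3 : t - 2 ≠ 0 := (sub_pos.2 ht).ne'
  field_simp
  ring

theorem chord_le {t K N : ℝ} (h2 : 2 ≤ N) (hN : N ≤ K) (hK : K < t) :
    (2 * N - 2) / (t - N) ≤ 2 / (t - 2) + 2 * (t - 1) * (N - 2) / ((t - K) * (t - 2)) := by
  rw [← sub_nonneg, chord_sub (hN.trans_lt hK) hK (by linarith)]
  have h1 : 0 ≤ t - 1 := by linarith
  have h3 : 0 ≤ N - 2 := by linarith
  have h4 : 0 ≤ K - N := by linarith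
  have h5 : 0 ≤ t - K := by linarith
  have h6 : 0 ≤ t - N := by linarith
  have h7 : 0 ≤ t - 2 := by linarith
  positivity

theorem eq_or_eq_of_chord_eq {t K N : ℝ} (h2 : 2 ≤ N) (hN : N ≤ K) (hK : K < t)
    (h : (2 * N - 2) / (t - N) = 2 / (t - 2) + 2 * (t - 1) * (N - 2) / ((t - K) * (t - 2))) :
    N = 2 ∨ N = K := by
  have h1 := chord_sub (hN.trans_lt hK) hK (by linarith)
  rw [← h, sub_self, eq_comm, div_eq_zero_iff] at h1
  have h3 : t - 1 ≠ 0 := by apply ne_of_gt; linarith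
  have h4 : t - K ≠ 0 := by apply ne_of_gt; linarith
  have h5 : t - N ≠ 0 := by apply ne_of_gt; linarith
  have h6 : t - 2 ≠ 0 := by apply ne_of_gt; linarith
  simpa [h3, h4, h5, h6, sub_eq_zero, eq_comm (a := K)] using h1

variable {ι : Type*} [Fintype ι] {N : ι → ℕ} {m k : ℕ} (h2 : ∀ i, 2 ≤ N i)
  (hcard : Fintype.card ι = k + 1) (hsum : ∑ i, N i = m + 2 * k + 2)
include h2 hcard hsum

theorem sum_sub_two : ∑ i, (N i - 2) = m := by
  have h : ∑ i, (N i - 2) + ∑ _i : ι, 2 = ∑ i, N i := by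
    rw [← Finset.sum_add_distrib]
    exact Finset.sum_congr rfl fun i _ => Nat.sub_add_cancel (h2 i)
  rw [Finset.sum_const, Finset.card_univ, hcard, hsum, smul_eq_mul] at h
  omega

theorem le_of_sum_eq (i : ι) : N i ≤ m + 2 := by
  have h := Finset.single_le_sum (f := fun i => N i - 2) (fun _ _ => Nat.zero_le _)
    (Finset.mem_univ i)
  rw [sum_sub_two h2 hcard hsum] at h
  omega

theorem exists_forall_ne_eq_two (h : ∀ i, N i = 2 ∨ N i = m + 2) :
    ∃ i, ∀ j, j ≠ i → N j = 2 := by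
  classical
  by_cases h' : ∃ i, N i ≠ 2
  · obtain ⟨i, hi⟩ := h'
    refine ⟨i, fun j hj => ?_⟩
    have h1 := sum_sub_two h2 hcard hsum
    rw [← Finset.add_sum_erase _ _ (Finset.mem_univ i)] at h1
    have h3 := Finset.single_le_sum (f := fun i => N i - 2) (fun _ _ => Nat.zero_le _)
      (Finset.mem_erase.2 ⟨hj, Finset.mem_univ j⟩)
    have := h i
    have := h2 j
    omega
  · have : Nonempty ι := Fintype.card_pos_iff.1 (by omega)
    push Not at h'
    exact ⟨Classical.arbitrary ι, fun j _ => h' j⟩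

variable {t : ℝ} (ht : m + 2 < t)
include ht

omit h2 in
theorem sum_chord : ∑ i, (2 / (t - 2) + 2 * (t - 1) * (N i - 2) / ((t - (m + 2)) * (t - 2))) =
    2 * (m + 1) / (t - (m + 2)) + 2 * k / (t - 2) := by
  have hm : (0 : ℝ) ≤ m := m.cast_nonneg
  have h3 : t - 2 ≠ 0 := by apply ne_of_gt; linarith
  have h4 : t - (m + 2) ≠ 0 := by apply ne_of_gt; linarith
  have h5 : ∑ i, ((N i : ℝ) - 2) = m := by
    rw [Finset.sum_sub_distrib, ← Nat.cast_sum, hsum, Finset.sum_const, Finset.card_univ, hcard]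
    push_cast [nsmul_eq_mul]
    ring
  rw [Finset.sum_add_distrib, ← Finset.sum_div (f := fun i => 2 * (t - 1) * ((N i : ℝ) - 2)),
    ← Finset.mul_sum, h5, Finset.sum_const, Finset.card_univ, hcard, nsmul_eq_mul]
  push_cast
  field_simp
  ring

theorem sum_div_le : ∑ i, (2 * (N i : ℝ) - 2) / (t - N i) ≤
    2 * (m + 1) / (t - (m + 2)) + 2 * k / (t - 2) := by
  rw [← sum_chord hcard hsum ht]
  exact Finset.sum_le_sum fun i _ => chord_le (mod_cast h2 i)
    (mod_cast le_of_sum_eq h2 hcard hsum i) ht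

theorem eq_or_eq_of_sum_div_eq (h : ∑ i, (2 * (N i : ℝ) - 2) / (t - N i) =
    2 * (m + 1) / (t - (m + 2)) + 2 * k / (t - 2)) (i : ι) : N i = 2 ∨ N i = m + 2 := by
  rw [← sum_chord hcard hsum ht] at h
  have hle : ∀ i, (N i : ℝ) ≤ m + 2 := fun i => mod_cast le_of_sum_eq h2 hcard hsum i
  have h3 := (Finset.sum_eq_sum_iff_of_le fun i _ => chord_le (mod_cast h2 i) (hle i) ht).1 h i
    (Finset.mem_univ i)
  exact_mod_cast eq_or_eq_of_chord_eq (mod_cast h2 i) (hle i) ht h3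

end ComponentSizes

section ForestCone

variable {V : Type*} [Fintype V] {F : SimpleGraph V} {m k : ℕ} {t : ℝ}

/-- Weights for which `coneVec` is a supersolution on the cone over a forest with an isolated
vertex added. -/
noncomputable def forestWeight (F : SimpleGraph V) (t : ℝ) : V ⊕ Fin 1 → ℝ :=
  Sum.elim (fun v => 1 / (t - compSize (F.connectedComponentMk v))) fun _ => 0

theorem edge_defect_eq {v w : V} (hvw : F.Adj v w)
    (ht : (compSize (F.connectedComponentMk v) : ℝ) < t) :
    1 + deg F v * (1 / (t - compSize (F.connectedComponentMk v))) +
      deg F w * (1 / (t - compSize (F.connectedComponentMk w))) -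
      t * (1 / (t - compSize (F.connectedComponentMk v))) =
    (deg F v + deg F w - compSize (F.connectedComponentMk v)) /
      (t - compSize (F.connectedComponentMk v)) := by
  have h := sub_ne_zero.2 ht.ne'
  rw [← ConnectedComponent.sound hvw.reachable]
  field_simp
  ring

variable (hF : F.IsAcyclic)
include hF

theorem sum_deg_mul_eq_sum_component [Fintype F.ConnectedComponent] :
    ∑ v, (deg F v : ℝ) * (1 / (t - compSize (F.connectedComponentMk v))) =
      ∑ C : F.ConnectedComponent, (2 * (compSize C : ℝ) - 2) / (t - compSize C) := by
  classical
  rw [← Finset.sum_fiberwise Finset.univ F.connectedComponentMk]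
  refine Finset.sum_congr rfl fun C _ => ?_
  have h : (∑ v with F.connectedComponentMk v = C, (deg F v : ℝ)) = 2 * compSize C - 2 := by
    have := sum_deg_component hF C
    rw [eq_sub_iff_add_eq]
    exact_mod_cast this
  rw [← h, Finset.sum_div]
  refine Finset.sum_congr rfl fun v hv => ?_
  rw [(Finset.mem_filter.1 hv).2, mul_one_div]

variable (hdeg : ∀ v, 1 ≤ deg F v) [Fintype F.ConnectedComponent]
  (hcomp : Fintype.card F.ConnectedComponent = k + 1) (hcard : Fintype.card V = m + 2 * k + 2)
  (ht : m + 2 < t)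
include hdeg hcomp hcard

theorem compSize_le (C : F.ConnectedComponent) : compSize C ≤ m + 2 :=
  le_of_sum_eq (two_le_compSize hF hdeg) hcomp (sum_compSize.trans hcard) C

include ht

theorem compSize_lt (C : F.ConnectedComponent) : (compSize C : ℝ) < t := by
  have : (compSize C : ℝ) ≤ m + 2 := mod_cast compSize_le hF hdeg hcomp hcard C
  linarith

theorem forestWeight_nonneg (v : V ⊕ Fin 1) : 0 ≤ forestWeight F t v := by
  rcases v with v | v
  · exact one_div_nonneg.2 (sub_nonneg.2 (compSize_lt hF hdeg hcomp hcard ht _).le)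
  · exact le_rfl

theorem edge_defect_nonpos {v w : V} (hvw : F.Adj v w) :
    1 + deg F v * (1 / (t - compSize (F.connectedComponentMk v))) +
      deg F w * (1 / (t - compSize (F.connectedComponentMk w))) -
      t * (1 / (t - compSize (F.connectedComponentMk v))) ≤ 0 := by
  have h := compSize_lt hF hdeg hcomp hcard ht (F.connectedComponentMk v)
  rw [edge_defect_eq hvw h]
  refine div_nonpos_of_nonpos_of_nonneg (sub_nonpos.2 ?_) (sub_nonneg.2 h.le)
  exact_mod_cast deg_add_deg_le_compSize hF hdeg hvw.ne (ConnectedComponent.sound hvw.reachable)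

variable [DecidableEq V] (hbal : t + 1 = (m + 2 * k + 3) * (1 + 1 / t) +
  2 / t * (2 * (m + 1) / (t - (m + 2)) + 2 * k / (t - 2)))
include hbal

omit hF hdeg [Fintype F.ConnectedComponent] hcomp ht in
theorem signlessLap_coneVec_forestWeight_none :
    (signlessLap (cone (dUnion F (pathGraph 1)))).mulVec
        (coneVec (dUnion F (pathGraph 1)) (forestWeight F t) t) none - (t + 1) =
      2 / t * (∑ v, (deg F v : ℝ) * (1 / (t - compSize (F.connectedComponentMk v))) -
        (2 * (m + 1) / (t - (m + 2)) + 2 * k / (t - 2))) := by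
  rw [signlessLap_coneVec_none, hbal]
  simp only [forestWeight, Fintype.sum_sum_type, Sum.elim_inl, Sum.elim_inr, deg_dUnion_inl,
    mul_zero, Finset.sum_const_zero, add_zero, Fintype.card_sum, hcard, Fintype.card_fin]
  push_cast
  ring

theorem signlessLap_coneVec_forestWeight_le (o : Option (V ⊕ Fin 1)) :
    (signlessLap (cone (dUnion F (pathGraph 1)))).mulVec
        (coneVec (dUnion F (pathGraph 1)) (forestWeight F t) t) o ≤
      (t + 1) * coneVec (dUnion F (pathGraph 1)) (forestWeight F t) t o := by
  classical
  have ht0 : 0 < t := by linarith [m.cast_nonneg (α := ℝ)]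
  cases o with
  | none =>
    rw [coneVec, mul_one, ← sub_nonpos, signlessLap_coneVec_forestWeight_none hcard hbal]
    refine mul_nonpos_of_nonneg_of_nonpos (by positivity) (sub_nonpos.2 ?_)
    rw [sum_deg_mul_eq_sum_component hF]
    exact sum_div_le (two_le_compSize hF hdeg) hcomp (sum_compSize.trans hcard) ht
  | some v =>
    rw [signlessLap_coneVec_some _ _ ht0.ne']
    refine add_le_of_nonpos_right (mul_nonpos_of_nonneg_of_nonpos (by positivity) ?_)
    refine Finset.sum_nonpos fun w _ => ?_
    split_ifs with hvw
    · rcases v with v | v <;> rcases w with w | w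
      · rw [dUnion_adj_inl] at hvw
        simpa only [deg_dUnion_inl, forestWeight, Sum.elim_inl] using
          edge_defect_nonpos hF hdeg hcomp hcard ht hvw
      · exact absurd hvw (by simp)
      · exact absurd hvw (by simp)
      · simp [Subsingleton.elim v w] at hvw
    · exact le_rfl

theorem qIndex_cone_forest_le : qIndex (cone (dUnion F (pathGraph 1))) ≤ t + 1 := by
  have ht0 : 0 < t := by linarith [m.cast_nonneg (α := ℝ)]
  exact qIndex_le_of_supersolution _
    (coneVec_pos _ (forestWeight_nonneg hF hdeg hcomp hcard ht) ht0)
    (signlessLap_coneVec_forestWeight_le hF hdeg hcomp hcard ht hbal)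

/-- In the extremal case at most one vertex of the forest is not a leaf. -/
theorem exists_center_of_qIndex_eq (hq : qIndex (cone (dUnion F (pathGraph 1))) = t + 1) :
    ∃ u, ∀ v, v ≠ u → deg F v = 1 := by
  classical
  have ht0 : 0 < t := by linarith [m.cast_nonneg (α := ℝ)]
  have heq := eq_of_supersolution_qIndex (cone (dUnion F (pathGraph 1)))
    (coneVec_pos _ (forestWeight_nonneg hF hdeg hcomp hcard ht) ht0)
    (by rw [hq]; exact signlessLap_coneVec_forestWeight_le hF hdeg hcomp hcard ht hbal) none
    (fun v hv => by cases v <;> simp at hv ⊢)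
  rw [hq] at heq
  have hedge : ∀ v w, F.Adj v w →
      deg F v + deg F w = compSize (F.connectedComponentMk v) := by
    intro v w hvw
    have h := heq (some (Sum.inl v))
    rw [signlessLap_coneVec_some _ _ ht0.ne', add_eq_left, mul_eq_zero,
      or_iff_right (by positivity), Finset.sum_eq_zero_iff_of_nonpos] at h
    · have h := h (Sum.inl w) (Finset.mem_univ _)
      have hlt := compSize_lt hF hdeg hcomp hcard ht (F.connectedComponentMk v)
      simp only [dUnion_adj_inl, hvw, if_true, deg_dUnion_inl, forestWeight, Sum.elim_inl] at h
      rw [edge_defect_eq hvw hlt, div_eq_zero_iff, or_iff_left (sub_ne_zero.2 hlt.ne'),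
        sub_eq_zero] at h
      exact_mod_cast h
    · rintro (w | w) _
      · split_ifs with hvw
        · rw [dUnion_adj_inl] at hvw
          simpa only [deg_dUnion_inl, forestWeight, Sum.elim_inl] using
            edge_defect_nonpos hF hdeg hcomp hcard ht hvw
        · exact le_rfl
      · simp
  have hsum := heq none
  rw [coneVec, mul_one, ← sub_eq_zero, signlessLap_coneVec_forestWeight_none hcard hbal,
    mul_eq_zero, or_iff_right (by positivity), sub_eq_zero, sum_deg_mul_eq_sum_component hF] at hsum
  obtain ⟨C, hC⟩ := exists_forall_ne_eq_two (two_le_compSize hF hdeg) hcomp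
    (sum_compSize.trans hcard) (eq_or_eq_of_sum_div_eq (two_le_compSize hF hdeg) hcomp
      (sum_compSize.trans hcard) ht hsum)
  obtain ⟨u, hu⟩ := exists_center_of_deg_add_deg_eq hF hdeg C
    fun v w hvw hv => hv ▸ hedge v w hvw
  refine ⟨u, fun v hv => ?_⟩
  by_cases h : F.connectedComponentMk v = C
  · exact hu v h hv
  · exact deg_eq_one_of_compSize_eq_two hF hdeg (hC _ h)

end ForestCone

section Structure

/-- A bijective graph homomorphism which does not increase degrees is an isomorphism. -/
theorem nonempty_iso_of_bijective_hom {V W : Type*} [Fintype V] [Fintype W] {G : SimpleGraph V}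
    {H : SimpleGraph W} (f : G →g H) (hf : Function.Bijective f)
    (hdeg : ∀ v, deg H (f v) ≤ deg G v) : Nonempty (G ≃g H) := by
  refine ⟨⟨Equiv.ofBijective f hf, fun {a b} => ⟨fun h => ?_, f.map_adj⟩⟩⟩
  have hsub : f '' G.neighborSet a ⊆ H.neighborSet (f a) := by
    rintro _ ⟨c, hc, rfl⟩
    exact f.map_adj hc
  have heq := Set.eq_of_subset_of_ncard_le hsub (by
    rw [Set.ncard_image_of_injective _ hf.1]
    exact hdeg a)
  obtain ⟨c, hc, hcb⟩ : f b ∈ f '' G.neighborSet a := heq ▸ h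
  exact hf.1 hcb ▸ hc

theorem nonempty_iso_star_matching {V : Type*} [Fintype V] {F : SimpleGraph V} {m k : ℕ} {u : V}
    (hleaf : ∀ v, v ≠ u → deg F v = 1) (hu : deg F u = m + 1)
    (hcard : Fintype.card V = m + 2 * k + 2) :
    Nonempty (F ≃g dUnion (starGraph (m + 2)) (matching k)) := by
  classical
  have hex : ∀ v, v ≠ u → ∃ w, F.neighborSet v = {w} := fun v hv =>
    Set.ncard_eq_one.1 (hleaf v hv)
  choose! f hf using hex
  replace hf : ∀ v, v ≠ u → ∀ w, F.Adj v w ↔ w = f v := fun v hv w => by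
    rw [← mem_neighborSet, hf v hv, Set.mem_singleton_iff]
  have hnu : ∀ v, F.Adj u v → f v = u := fun v hv =>
    ((hf v hv.ne' u).1 hv.symm).symm
  have hadj : ∀ v, v ≠ u → F.Adj v (f v) := fun v hv => (hf v hv _).2 rfl
  have hfu : ∀ v, v ≠ u → ¬ F.Adj u v → f v ≠ u := fun v hv hv' h =>
    hv' (h ▸ hadj v hv).symm
  have hff : ∀ v, v ≠ u → ¬ F.Adj u v → f (f v) = v := fun v hv hv' =>
    ((hf _ (hfu v hv hv') v).1 (hadj v hv).symm).symm
  have hfa : ∀ v, v ≠ u → ¬ F.Adj u v → ¬ F.Adj u (f v) := fun v hv hv' h =>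
    hv ((hff v hv hv').symm.trans (hnu _ h))
  let n := Fintype.equivFin V
  let P := {v : V // v ≠ u ∧ ¬ F.Adj u v ∧ n v < n (f v)}
  have hN : Nat.card (F.neighborSet u) = m + 1 := hu
  let e : Fin (m + 1) ≃ F.neighborSet u := (Finite.equivFinOfCardEq hN).symm
  let ψ : Fin (m + 2) ⊕ (P × Fin 2) → V :=
    Sum.elim (Fin.cons u fun i => (e i : V)) fun p => if p.2 = 0 then p.1 else f p.1
  have hstar : ∀ i : Fin (m + 2), ψ (Sum.inl i) = u ∨ F.Adj u (ψ (Sum.inl i)) := fun i =>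
    i.cases (Or.inl rfl) fun i => Or.inr (e i).2
  have hmatch : ∀ p, ψ (Sum.inr p) ≠ u ∧ ¬ F.Adj u (ψ (Sum.inr p)) := by
    rintro ⟨⟨v, hv, hv', _⟩, j⟩
    by_cases hj : j = 0
    · simpa [ψ, hj] using ⟨hv, hv'⟩
    · simpa [ψ, hj] using ⟨hfu v hv hv', hfa v hv hv'⟩
  have hψ : Function.Bijective ψ := by
    constructor
    · rintro (i | p) (j | q) h
      · have : Function.Injective (Fin.cons u fun i => (e i : V) : Fin (m + 2) → V) :=
          Fin.cons_injective_iff.2 ⟨fun ⟨i, hi⟩ => (e i).2.ne hi.symm,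
            Subtype.val_injective.comp e.injective⟩
        exact congrArg _ (this h)
      · exact absurd (h ▸ hstar i) (not_or.2 (hmatch q))
      · exact absurd (h ▸ hstar j) (not_or.2 (h ▸ hmatch p))
      · obtain ⟨⟨v, hv, hv', hlt⟩, i⟩ := p
        obtain ⟨⟨w, hw, hw', hlt'⟩, j⟩ := q
        fin_cases i <;> fin_cases j <;> simp [ψ] at h ⊢
        · exact Subtype.ext h
        · rw [h, hff w hw hw'] at hlt
          exact hlt.asymm hlt'
        · rw [← h, hff v hv hv'] at hlt'
          exact hlt.asymm hlt'
        · exact Subtype.ext ((hff v hv hv').symm.trans ((congrArg f h).trans (hff w hw hw')))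
    · intro v
      by_cases hv : v = u
      · exact ⟨Sum.inl 0, hv.symm⟩
      by_cases hv' : F.Adj u v
      · exact ⟨Sum.inl (e.symm ⟨v, hv'⟩).succ, by simp [ψ]⟩
      rcases lt_trichotomy (n v) (n (f v)) with h | h | h
      · exact ⟨Sum.inr (⟨v, hv, hv', h⟩, 0), by simp [ψ]⟩
      · exact absurd (n.injective h) (hadj v hv).ne
      · exact ⟨Sum.inr (⟨f v, hfu v hv hv', hfa v hv hv', by rwa [hff v hv hv']⟩, 1),
          by simp [ψ, hff v hv hv']⟩
  have hP : Nat.card P = k := by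
    have := Fintype.card_of_bijective hψ
    simp only [Fintype.card_sum, Fintype.card_prod, Fintype.card_fin, hcard] at this
    rw [Nat.card_eq_fintype_card]
    omega
  let g : Fin (m + 2) ⊕ (Fin k × Fin 2) ≃ Fin (m + 2) ⊕ (P × Fin 2) :=
    Equiv.sumCongr (Equiv.refl _)
      (Equiv.prodCongr (Finite.equivFinOfCardEq hP).symm (Equiv.refl _))
  let φ : dUnion (starGraph (m + 2)) (matching k) →g F :=
    { toFun := ψ ∘ g
      map_rel' := by
        rintro (i | ⟨i, i'⟩) (j | ⟨j, j'⟩) h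
        · rw [dUnion_adj_inl, starGraph_adj] at h
          induction i using Fin.cases <;> induction j using Fin.cases
          · simp at h
          · exact (e _).2
          · exact (e _).2.symm
          · simp at h
        · simp at h
        · simp at h
        · rw [dUnion_adj_inr, matching_adj] at h
          obtain ⟨h, rfl : i = j⟩ := h
          have := hadj _ ((Finite.equivFinOfCardEq hP).symm i).2.1
          fin_cases i' <;> fin_cases j' <;> simp [ψ, g] at h ⊢
          exacts [this, this.symm] }
  obtain ⟨iso⟩ := nonempty_iso_of_bijective_hom φ (hψ.comp g.bijective) (by
    rintro (i | p)
    · induction i using Fin.cases with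
      | zero =>
        rw [deg_dUnion_inl, deg_starGraph_zero]
        exact hu.le
      | succ i =>
        rw [deg_dUnion_inl, deg_starGraph_succ]
        exact (hleaf _ (e i).2.ne').le
    · rw [deg_dUnion_inr, deg_matching]
      exact (hleaf _ (hmatch _).1).le)
  exact ⟨iso.symm⟩

theorem deg_center_eq {V : Type*} [Fintype V] {F : SimpleGraph V} {m k : ℕ} {u : V}
    (hleaf : ∀ v, v ≠ u → deg F v = 1) (hedges : numEdges F = m + k + 1)
    (hcard : Fintype.card V = m + 2 * k + 2) : deg F u = m + 1 := by
  classical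
  have h := sum_deg_eq F
  rw [← Finset.add_sum_erase _ _ (Finset.mem_univ u),
    Finset.sum_congr rfl fun v hv => hleaf v (Finset.ne_of_mem_erase hv), Finset.sum_const,
    Finset.card_erase_of_mem (Finset.mem_univ u), Finset.card_univ, hcard, hedges,
    smul_eq_mul] at h
  omega

end Structure

theorem stmt7 {V : Type*} [Fintype V] [DecidableEq V] (F : SimpleGraph V) (r s : ℕ)
    (hforest : F.IsAcyclic) (hcomp : Nat.card F.ConnectedComponent = r)
    (hsize : numEdges F = s) (hmin1 : ∀ v, 1 ≤ deg F v) (hmin2 : ∃ v, deg F v = 1) :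
    qIndex (cone (dUnion F (pathGraph 1))) ≤
      qIndex (cone (dUnion (starGraph (s - r + 2)) (dUnion (matching (r - 1)) (pathGraph 1)))) ∧
      (qIndex (cone (dUnion F (pathGraph 1))) =
          qIndex (cone (dUnion (starGraph (s - r + 2)) (dUnion (matching (r - 1)) (pathGraph 1)))) ↔
        Nonempty (F ≃g dUnion (starGraph (s - r + 2)) (matching (r - 1)))) := by
  classical
  have : Fintype F.ConnectedComponent := Fintype.ofFinite _
  have hV := card_eq_numEdges_add_card_component hforest
  rw [hcomp, hsize] at hV
  rw [Nat.card_eq_fintype_card] at hcomp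
  have hr : 0 < r := by
    obtain ⟨v, -⟩ := hmin2
    exact hcomp ▸ Fintype.card_pos_iff.2 ⟨F.connectedComponentMk v⟩
  have hrs : r ≤ s := by
    have h := Finset.card_nsmul_le_sum Finset.univ (fun C : F.ConnectedComponent => compSize C) 2
      fun C _ => two_le_compSize hforest hmin1 C
    rw [sum_compSize, Finset.card_univ, hcomp, hV, smul_eq_mul] at h
    omega
  obtain ⟨k, rfl⟩ : ∃ k, r = k + 1 := ⟨r - 1, by omega⟩
  obtain ⟨m, rfl⟩ := Nat.exists_eq_add_of_le hrs
  rw [Nat.add_sub_cancel_left, Nat.add_sub_cancel]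
  obtain ⟨t, ht, hbal⟩ := exists_balance m k
  have hcard : Fintype.card V = m + 2 * k + 2 := by omega
  rw [qIndex_cone_star_matching m k ht hbal]
  refine ⟨qIndex_cone_forest_le hforest hmin1 hcomp hcard ht hbal, fun h => ?_, fun ⟨e⟩ => ?_⟩
  · obtain ⟨u, hu⟩ := exists_center_of_qIndex_eq hforest hmin1 hcomp hcard ht hbal h
    exact nonempty_iso_star_matching hu (deg_center_eq hu (by omega) hcard) hcard
  · rw [← qIndex_cone_star_matching m k ht hbal]
    exact qIndex_congr _ (coneIso ((dUnionIsoLeft e _).trans (dUnionAssoc _ _ _)))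

end QPaper
end

section
/- For every integer k ≥ 3, q(K_1 ∨ ((k−3)P_2 ∪ 2S_3 ∪ P_1)) > q(K_1 ∨ ((k−1)P_2 ∪ S_3)). -/
namespace QPaper

open SimpleGraph

section Spectral

variable {V : Type*} [Fintype V] [DecidableEq V]

open Classical in
theorem signlessLap_mulVec_apply (G : SimpleGraph V) (x : V → ℝ) (v : V) :
    (signlessLap G).mulVec x v = ∑ u, if G.Adj v u then x v + x u else 0 := by
  unfold signlessLap
  simp only [Matrix.add_mulVec, Pi.add_apply, degMatrix_mulVec_apply, adjMatrix_mulVec_apply]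
  rw [← Finset.sum_filter, Finset.sum_add_distrib, Finset.sum_const, nsmul_eq_mul,
    ← neighborFinset_eq_filter, card_neighborFinset_eq_degree]

theorem isHermitian_signlessLap (G : SimpleGraph V) : (signlessLap G).IsHermitian := by
  classical
  unfold signlessLap
  rw [Matrix.IsHermitian, Matrix.conjTranspose_eq_transpose_of_trivial]
  simp [degMatrix]

theorem exists_mulVec_eq_qIndex_smul [Nonempty V] (G : SimpleGraph V) :
    ∃ x ≠ 0, (signlessLap G).mulVec x = qIndex G • x := by
  have hA := isHermitian_signlessLap G
  have hmem : qIndex G ∈ spectrum ℝ (signlessLap G) := by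
    unfold qIndex
    rw [hA.spectrum_real_eq_range_eigenvalues]
    exact (Set.range_nonempty _).csSup_mem (Set.finite_range _)
  rw [← Matrix.spectrum_toLin', ← Module.End.hasEigenvalue_iff_mem_spectrum] at hmem
  obtain ⟨x, hx⟩ := hmem.exists_hasEigenvector
  exact ⟨x, hx.2, by simpa using hx.apply_eq_smul⟩

theorem dotProduct_signlessLap_mulVec_le (G : SimpleGraph V) (x : V → ℝ) :
    x ⬝ᵥ (signlessLap G).mulVec x ≤ qIndex G * (x ⬝ᵥ x) := by
  have hA := isHermitian_signlessLap G
  have hbdd : BddAbove (spectrum ℝ (signlessLap G)) := by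
    rw [hA.spectrum_real_eq_range_eigenvalues]
    exact (Set.finite_range _).bddAbove
  have hpos : (algebraMap ℝ (Matrix V V ℝ) (qIndex G) - signlessLap G).PosSemidef := by
    rw [Matrix.posSemidef_iff_isHermitian_and_spectrum_nonneg]
    refine ⟨?_, ?_⟩
    · refine Matrix.IsHermitian.sub ?_ hA
      rw [Matrix.IsHermitian, Matrix.conjTranspose_eq_transpose_of_trivial,
        Matrix.algebraMap_eq_diagonal, Matrix.diagonal_transpose]
    · rw [← spectrum.singleton_sub_eq]
      rintro _ ⟨_, rfl, b, hb, rfl⟩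
      exact sub_nonneg.2 (le_csSup hbdd hb)
  have h := hpos.dotProduct_mulVec_nonneg x
  rw [Algebra.algebraMap_eq_smul_one, Matrix.sub_mulVec, Matrix.smul_mulVec, Matrix.one_mulVec,
    dotProduct_sub, dotProduct_smul] at h
  simpa using h

end Spectral

/-- The action of the signless Laplacian, in a form free of decidability instances. -/
noncomputable def signlessSum {V : Type*} [Fintype V] (G : SimpleGraph V) (x : V → ℝ) (v : V) :
    ℝ :=
  open Classical in ∑ u, if G.Adj v u then x v + x u else 0

section Sum

variable {α β : Type*} [Fintype α] [Fintype β]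

theorem signlessSum_cone_none (H : SimpleGraph α) (x : Option α → ℝ) :
    signlessSum (cone H) x none = ∑ u, (x none + x (some u)) := by
  simp [signlessSum, cone, Fintype.sum_option]

theorem signlessSum_cone_some (H : SimpleGraph α) (x : Option α → ℝ) (v : α) :
    signlessSum (cone H) x (some v) =
      x (some v) + x none + signlessSum H (fun u => x (some u)) v := by
  have h (u : α) : (cone H).Adj (some v) (some u) ↔ H.Adj v u := by
    simpa [cone, H.adj_comm u v] using fun h : H.Adj v u => h.ne
  have h' : (cone H).Adj (some v) none := by simp [cone]
  simp only [signlessSum, Fintype.sum_option, h', if_true]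
  classical
  exact congrArg _ (Finset.sum_congr rfl fun u _ => if_congr (h u) rfl rfl)

theorem signlessSum_dUnion_inl (G : SimpleGraph α) (H : SimpleGraph β) (x : α ⊕ β → ℝ) (v : α) :
    signlessSum (dUnion G H) x (.inl v) = signlessSum G (fun u => x (.inl u)) v := by
  have h (u : α) : (dUnion G H).Adj (.inl v) (.inl u) ↔ G.Adj v u := by
    simpa [dUnion, G.adj_comm u v] using fun h : G.Adj v u => h.ne
  have h' (u : β) : ¬ (dUnion G H).Adj (.inl v) (.inr u) := by simp [dUnion]
  simp only [signlessSum, Fintype.sum_sum_type, h', if_false, Finset.sum_const_zero, add_zero]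
  classical
  exact Finset.sum_congr rfl fun u _ => if_congr (h u) rfl rfl

theorem signlessSum_dUnion_inr (G : SimpleGraph α) (H : SimpleGraph β) (x : α ⊕ β → ℝ) (v : β) :
    signlessSum (dUnion G H) x (.inr v) = signlessSum H (fun u => x (.inr u)) v := by
  have h (u : β) : (dUnion G H).Adj (.inr v) (.inr u) ↔ H.Adj v u := by
    simpa [dUnion, H.adj_comm u v] using fun h : H.Adj v u => h.ne
  have h' (u : α) : ¬ (dUnion G H).Adj (.inr v) (.inl u) := by simp [dUnion]
  simp only [signlessSum, Fintype.sum_sum_type, h', if_false, Finset.sum_const_zero, zero_add]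
  classical
  exact Finset.sum_congr rfl fun u _ => if_congr (h u) rfl rfl

theorem signlessSum_matching (n : ℕ) (x : Fin n × Fin 2 → ℝ) (i : Fin n) (j : Fin 2) :
    signlessSum (matching n) x (i, j) = x (i, 0) + x (i, 1) := by
  have h (a : Fin n) (b : Fin 2) : (matching n).Adj (i, j) (a, b) ↔ a = i ∧ b ≠ j := by
    simp only [matching, fromRel_adj, ne_eq, Prod.mk.injEq]
    grind
  simp only [signlessSum, Fintype.sum_prod_type, h, Fin.sum_univ_two]
  rw [Finset.sum_eq_single i (by simp +contextual) (by simp)]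
  fin_cases j <;> simp [add_comm]

theorem signlessSum_starGraph_three (x : Fin 3 → ℝ) :
    signlessSum (starGraph 3) x 0 = 2 * x 0 + x 1 + x 2 ∧
      signlessSum (starGraph 3) x 1 = x 0 + x 1 ∧ signlessSum (starGraph 3) x 2 = x 0 + x 2 := by
  simp only [signlessSum, starGraph, fromRel_adj, Fin.sum_univ_three]
  refine ⟨?_, ?_, ?_⟩ <;> simp <;> ring

theorem signlessSum_pathGraph_one (x : Fin 1 → ℝ) (v : Fin 1) :
    signlessSum (pathGraph 1) x v = 0 := by
  have h (u : Fin 1) : ¬ (pathGraph 1).Adj v u := fun h => h.ne (Subsingleton.elim _ _)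
  simp [signlessSum, h]

theorem card_le_qIndex_cone [DecidableEq α] (H : SimpleGraph α) :
    (Fintype.card α : ℝ) ≤ qIndex (cone H) := by
  have h := dotProduct_signlessLap_mulVec_le (cone H) (Pi.single none 1)
  rw [single_one_dotProduct, single_one_dotProduct, signlessLap_mulVec_apply] at h
  have h' := signlessSum_cone_none H (Pi.single none 1)
  rw [signlessSum] at h'
  rw [h'] at h
  simpa using h

/-- A vector that is a `q`-eigenvector up to a positive surplus at the hub certifies that the
`Q`-index of a cone exceeds `q`. -/
theorem lt_qIndex_cone [DecidableEq α] (H : SimpleGraph α) (q : ℝ) (x : α → ℝ)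
    (hx : ∀ v, x v + 1 + signlessSum H x v = q * x v) (hq : q < ∑ u, (1 + x u)) :
    q < qIndex (cone H) := by
  set y : Option α → ℝ := fun o => o.elim 1 x with hy
  have h := dotProduct_signlessLap_mulVec_le (cone H) y
  have hnone : (signlessLap (cone H)).mulVec y none = ∑ u, (1 + x u) := by
    rw [signlessLap_mulVec_apply]
    exact signlessSum_cone_none H y
  have hsome (v : α) : (signlessLap (cone H)).mulVec y (some v) = q * x v := by
    rw [signlessLap_mulVec_apply, ← hx]
    exact signlessSum_cone_some H y v
  simp only [dotProduct, Fintype.sum_option, hnone, hsome] at h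
  simp only [hy, Option.elim, one_mul, mul_left_comm _ q, ← Finset.mul_sum] at h
  have hS : 0 ≤ ∑ v, x v * x v := Finset.sum_nonneg fun v _ => mul_self_nonneg _
  nlinarith

/-- The hub equation of a cone: if for `q = q(K₁ ∨ H)` every solution of the equations away from
the hub is the multiple `t • z` of one vector, then `q` solves the equation at the hub. -/
theorem qIndex_cone_eq_sum [DecidableEq α] (H : SimpleGraph α) (z : α → ℝ)
    (hz : ∀ (t : ℝ) (x : α → ℝ), (∀ v, x v + t + signlessSum H x v = qIndex (cone H) * x v) →
      ∀ v, x v = t * z v) :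
    qIndex (cone H) = ∑ u, (1 + z u) := by
  obtain ⟨x, hx0, hx⟩ := exists_mulVec_eq_qIndex_smul (cone H)
  have hsome : ∀ v, x (some v) = x none * z v := hz (x none) (fun v => x (some v)) fun v => by
    rw [← signlessSum_cone_some]
    exact (signlessLap_mulVec_apply (cone H) x (some v)).symm.trans (congrFun hx (some v))
  have hnone : ∑ u, (x none + x (some u)) = qIndex (cone H) * x none := by
    rw [← signlessSum_cone_none]
    exact (signlessLap_mulVec_apply (cone H) x none).symm.trans (congrFun hx none)
  have ht : x none ≠ 0 := by
    intro h0
    refine hx0 (funext fun o => ?_)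
    cases o with
    | none => exact h0
    | some v => simp [hsome, h0]
  refine mul_right_cancel₀ ht ?_
  rw [← hnone, Finset.sum_mul]
  exact Finset.sum_congr rfl fun u _ => by rw [hsome]; ring

end Sum

/-- The weights of `S₃` in a `q`-eigenvector of a cone with hub weight `1`. -/
noncomputable def starWeight (q : ℝ) : Fin 3 → ℝ :=
  ![q / ((q - 1) * (q - 4)), (q - 2) / ((q - 1) * (q - 4)), (q - 2) / ((q - 1) * (q - 4))]

theorem starWeight_spec {q : ℝ} (hq : 4 < q) (v : Fin 3) :
    starWeight q v + 1 + signlessSum (starGraph 3) (starWeight q) v = q * starWeight q v := by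
  obtain ⟨h0, h1, h2⟩ := signlessSum_starGraph_three (starWeight q)
  have hq1 : q - 1 ≠ 0 := by linarith
  have hq4 : q - 4 ≠ 0 := by linarith
  fin_cases v <;> simp only [Fin.zero_eta, Fin.mk_one, Fin.reduceFinMk, h0, h1, h2] <;>
    simp [starWeight] <;> field_simp <;> ring

theorem eq_starWeight {q : ℝ} (hq : 4 < q) {t : ℝ} {x : Fin 3 → ℝ}
    (hx : ∀ v, x v + t + signlessSum (starGraph 3) x v = q * x v) (v : Fin 3) :
    x v = t * starWeight q v := by
  obtain ⟨h0, h1, h2⟩ := signlessSum_starGraph_three x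
  have e0 := hx 0
  have e1 := hx 1
  have e2 := hx 2
  rw [h0] at e0
  rw [h1] at e1
  rw [h2] at e2
  have hq1 : q - 1 ≠ 0 := by linarith
  have hq2 : q - 2 ≠ 0 := by linarith
  have hq4 : q - 4 ≠ 0 := by linarith
  have c0 : x 0 = t * (q / ((q - 1) * (q - 4))) := by
    field_simp
    linear_combination (2 - q) * e0 - e1 - e2
  have leaf {y : ℝ} (hy : y + t + (x 0 + y) = q * y) :
      y = t * ((q - 2) / ((q - 1) * (q - 4))) := by
    refine mul_left_cancel₀ hq2 ?_
    rw [show (q - 2) * y = x 0 + t by linarith, c0]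
    field_simp
    ring
  fin_cases v
  · exact c0
  · exact leaf e1
  · exact leaf e2

theorem stmt10 (k : ℕ) (hk : 3 ≤ k) :
    qIndex (cone (dUnion (matching (k - 3)) (dUnion (dUnion (starGraph 3) (starGraph 3)) (pathGraph 1)))) > qIndex (cone (dUnion (matching (k - 1)) (starGraph 3))) := by
  have hkm : k - 1 = k - 3 + 2 := by omega
  rw [hkm]
  generalize k - 3 = m
  set q := qIndex (cone (dUnion (matching (m + 2)) (starGraph 3))) with hqdef
  have hq : 4 < q := by
    have h := card_le_qIndex_cone (dUnion (matching (m + 2)) (starGraph 3))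
    rw [← hqdef] at h
    simp only [Fintype.card_sum, Fintype.card_prod, Fintype.card_fin] at h
    push_cast at h
    have : (0 : ℝ) ≤ m := m.cast_nonneg
    linarith
  have hq1 : q - 1 ≠ 0 := by linarith
  have hq3 : q - 3 ≠ 0 := by linarith
  have hub : q = ∑ u : (Fin (m + 2) × Fin 2) ⊕ Fin 3,
      (1 + Sum.elim (fun _ => 1 / (q - 3)) (starWeight q) u) := by
    refine qIndex_cone_eq_sum _ _ fun t x hx v => ?_
    rw [← hqdef] at hx
    rcases v with ⟨i, j⟩ | v
    · have e0 := hx (.inl (i, 0))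
      have e1 := hx (.inl (i, 1))
      rw [signlessSum_dUnion_inl, signlessSum_matching] at e0 e1
      have hsymm : x (.inl (i, 0)) = x (.inl (i, 1)) :=
        mul_left_cancel₀ hq1 (by linear_combination e1 - e0)
      simp only [Sum.elim_inl]
      field_simp
      fin_cases j
      · simp only [Fin.zero_eta]
        linear_combination -hsymm - e0
      · simp only [Fin.mk_one]
        linear_combination hsymm - e1
    · exact eq_starWeight hq (x := fun u => x (.inr u))
        (fun u => by simpa only [signlessSum_dUnion_inr] using hx (.inr u)) v
  refine lt_qIndex_cone _ q (Sum.elim (fun _ => 1 / (q - 3))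
    (Sum.elim (Sum.elim (starWeight q) (starWeight q)) fun _ => 1 / (q - 1))) ?_ ?_
  · rintro (⟨i, j⟩ | (v | v) | v)
    · simp only [signlessSum_dUnion_inl, signlessSum_matching, Sum.elim_inl]
      field_simp
      ring
    · simpa only [signlessSum_dUnion_inl, signlessSum_dUnion_inr, Sum.elim_inl, Sum.elim_inr]
        using starWeight_spec hq v
    · simpa only [signlessSum_dUnion_inl, signlessSum_dUnion_inr, Sum.elim_inl, Sum.elim_inr]
        using starWeight_spec hq v
    · simp only [signlessSum_dUnion_inr, signlessSum_pathGraph_one, Sum.elim_inr]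
      field_simp
      ring
  · have hstar : ∑ v, (1 + starWeight q v) = 3 + (3 * q - 4) / ((q - 1) * (q - 4)) := by
      simp [Fin.sum_univ_three, starWeight]
      ring
    simp only [Fintype.sum_sum_type, Sum.elim_inl, Sum.elim_inr, hstar, Finset.sum_const,
      Finset.card_univ, Fintype.card_prod, Fintype.card_fin, nsmul_eq_mul] at hub ⊢
    push_cast at hub ⊢
    have hgap : (3 * q - 4) / ((q - 1) * (q - 4)) + 1 / (q - 1) - 4 * (1 / (q - 3)) =
        8 / ((q - 1) * (q - 3) * (q - 4)) := by
      have hq4 : q - 4 ≠ 0 := by linarith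
      field_simp
      ring
    have hpos : 0 < 8 / ((q - 1) * (q - 3) * (q - 4)) := by
      have h1 : 0 < q - 1 := by linarith
      have h3 : 0 < q - 3 := by linarith
      have h4 : 0 < q - 4 := by linarith
      positivity
    linarith

end QPaper
end
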